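/- arXiv:1301.3436 — 2 statements merged into one kernel-verified Lean document; each statement's English description precedes it below -/
import Mathlib

section
/- Let η ≥ 0 and N ≥ 1, and let ψ ∈ C_c^∞(ℝ^N; ℂ) be symmetric and normalized (∫|ψ|² = 1). Define the one-particle density ρ(x) := N·∫_{ℝ^{N−1}} |ψ(x, x_2, …, x_N)|² dx_2⋯dx_N, its Hardy–Littlewood maximal function ρ*(x) := sup{ (∫_Q ρ)/|Q| : Q a finite interval containing x }, and the Lieb–Liniger kinetic energy T_S(ψ) := (1/2)·∫_{ℝ^N} ‖∇ψ‖² dx + 2η·∑_{1≤j<k≤N} ∫_{ℝ^{N−1}} |ψ(x)|²|_{x_j = x_k = t} dt ∏_{l≠j,k} dx_l. Then T_S(ψ) ≥ 3·10⁻⁵ · ∫_ℝ ξ_S(2η/ρ*(x))² · ρ(x)³ dx, where the integrand is interpreted as 0 at points where ρ(x) = 0. -/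
open MeasureTheory

/-- The point of `ℝᴺ` whose `j`-th and `k`-th coordinates equal `t` and whose remaining
coordinates are given by `z`. -/
def insertPair {N : ℕ} (j k : Fin N) (t : ℝ)
    (z : {l : Fin N // l ≠ j ∧ l ≠ k} → ℝ) : Fin N → ℝ :=
  fun l => if h : l = j ∨ l = k then t else z ⟨l, not_or.mp h⟩

/-- `∫ |ψ|²` over all particle coordinates except the `j`-th one, which is set to `y`. -/
noncomputable def densityAt {N : ℕ} (ψ : (Fin N → ℝ) → ℂ) (j : Fin N) (y : ℝ) : ℝ :=
  ∫ z : {k : Fin N // k ≠ j} → ℝ,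
    ‖ψ (fun k => if h : k = j then y else z ⟨k, h⟩)‖ ^ 2

/-- The (uncentered) Hardy–Littlewood maximal function of `ρ`. -/
noncomputable def maximalFn (ρ : ℝ → ℝ) (x : ℝ) : ℝ :=
  sSup {t : ℝ | ∃ a b : ℝ, a < b ∧ x ∈ Set.Icc a b ∧
    t = (∫ y in Set.Icc a b, ρ y) / (b - a)}


/-- The Riccati substitution `w x = k * tan (k * (x - c))`, which solves `w' - w ^ 2 = k ^ 2`. -/
theorem sq_mul_integral_norm_sq_le_of_tan {f f' : ℝ → ℂ} (hf : ∀ x, HasDerivAt f (f' x) x)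
    (hf' : Continuous f') {k c y z : ℝ} (hyz : y ≤ z)
    (hpos : ∀ x ∈ Set.Icc y z, 0 < Real.cos (k * (x - c))) :
    k ^ 2 * ∫ x in y..z, ‖f x‖ ^ 2 ≤ (∫ x in y..z, ‖f' x‖ ^ 2)
      + (k * Real.tan (k * (z - c)) * ‖f z‖ ^ 2 - k * Real.tan (k * (y - c)) * ‖f y‖ ^ 2) := by
  have hfc : Continuous f := continuous_iff_continuousAt.2 fun x => (hf x).continuousAt
  have hder : ∀ x ∈ Set.uIcc y z,
      HasDerivAt (fun x => k * Real.tan (k * (x - c)) * ‖f x‖ ^ 2)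
        (k * (1 / Real.cos (k * (x - c)) ^ 2 * k) * ‖f x‖ ^ 2
          + k * Real.tan (k * (x - c)) * (2 * inner ℝ (f x) (f' x))) x := by
    intro x hx
    rw [Set.uIcc_of_le hyz] at hx
    have h1 : HasDerivAt (fun x : ℝ => k * (x - c)) k x := by
      simpa using ((hasDerivAt_id x).sub_const c).const_mul k
    exact (((Real.hasDerivAt_tan (hpos x hx).ne').comp x h1).const_mul k).mul (hf x).norm_sq
  have hc : ContinuousOn (fun x => Real.cos (k * (x - c))) (Set.uIcc y z) := by fun_prop
  have hcne : ∀ x ∈ Set.uIcc y z, Real.cos (k * (x - c)) ≠ 0 := fun x hx =>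
    (hpos x (by rwa [Set.uIcc_of_le hyz] at hx)).ne'
  have htan : ContinuousOn (fun x => Real.tan (k * (x - c))) (Set.uIcc y z) := by
    simp only [Real.tan_eq_sin_div_cos]
    exact ContinuousOn.div (by fun_prop) hc hcne
  have hcont : ContinuousOn (fun x => k * (1 / Real.cos (k * (x - c)) ^ 2 * k) * ‖f x‖ ^ 2
          + k * Real.tan (k * (x - c)) * (2 * inner ℝ (f x) (f' x))) (Set.uIcc y z) := by
    have : ContinuousOn (fun x => 1 / Real.cos (k * (x - c)) ^ 2) (Set.uIcc y z) :=
      continuousOn_const.div (hc.pow 2) fun x hx => pow_ne_zero 2 (hcne x hx)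
    fun_prop
  have hint : IntervalIntegrable (fun x => ‖f' x‖ ^ 2) volume y z :=
    Continuous.intervalIntegrable (by fun_prop) _ _
  rw [← intervalIntegral.integral_eq_sub_of_hasDerivAt hder hcont.intervalIntegrable,
    ← intervalIntegral.integral_add hint hcont.intervalIntegrable,
    ← intervalIntegral.integral_const_mul]
  refine intervalIntegral.integral_mono_on hyz
    (Continuous.intervalIntegrable (by fun_prop) _ _)
    (hint.add hcont.intervalIntegrable) fun x hx => ?_
  have hcos := hpos x hx
  have hsec : 1 / Real.cos (k * (x - c)) ^ 2 = 1 + Real.tan (k * (x - c)) ^ 2 := by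
    rw [Real.tan_eq_sin_div_cos]
    field_simp
    linarith [Real.sin_sq_add_cos_sq (k * (x - c))]
  rw [hsec]
  set w := k * Real.tan (k * (x - c)) with hw
  have h2 : -(|w| * (‖f x‖ * ‖f' x‖)) ≤ w * inner ℝ (f x) (f' x) := by
    have := neg_abs_le (w * inner ℝ (f x) (f' x))
    rw [abs_mul] at this
    have h3 := mul_le_mul_of_nonneg_left (abs_real_inner_le_norm (f x) (f' x)) (abs_nonneg w)
    linarith
  have h4 := sq_nonneg (‖f' x‖ - |w| * ‖f x‖)
  have h5 : k * ((1 + Real.tan (k * (x - c)) ^ 2) * k) = k ^ 2 + |w| ^ 2 := by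
    rw [sq_abs, hw]; ring
  rw [h5]
  nlinarith

/-- Lower bound for the Neumann energy on an interval with a delta potential at `y`. -/
theorem pinned_interval_inequality {f f' : ℝ → ℂ} (hf : ∀ x, HasDerivAt f (f' x) x)
    (hf' : Continuous f') {a b y θ η : ℝ} (hab : a < b) (hy : y ∈ Set.Icc a b)
    (hθ : 0 ≤ θ) (hθ2 : θ < Real.pi / 2) (hη : θ * Real.tan θ ≤ η * (b - a)) :
    (θ / (b - a)) ^ 2 * ∫ x in a..b, ‖f x‖ ^ 2
      ≤ (∫ x in a..b, ‖f' x‖ ^ 2) + 2 * η * ‖f y‖ ^ 2 := by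
  have hfc : Continuous f := continuous_iff_continuousAt.2 fun x => (hf x).continuousAt
  have hL : 0 < b - a := sub_pos.2 hab
  set k := θ / (b - a) with hk
  have hk0 : 0 ≤ k := div_nonneg hθ hL.le
  have hkL : k * (b - a) = θ := by rw [hk]; field_simp
  have hkt : k * Real.tan θ ≤ η := by
    rw [hk, div_mul_eq_mul_div, div_le_iff₀ hL]; exact hη
  have hle : ∀ s, 0 ≤ s → s ≤ b - a → k * Real.tan (k * s) ≤ η := by
    intro s hs hs2
    refine le_trans (mul_le_mul_of_nonneg_left ?_ hk0) hkt
    have h1 : k * s ≤ θ := hkL ▸ mul_le_mul_of_nonneg_left hs2 hk0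
    have h0 : 0 ≤ k * s := mul_nonneg hk0 hs
    exact Real.strictMonoOn_tan.monotoneOn ⟨by linarith [Real.pi_pos], by linarith⟩
      ⟨by linarith [Real.pi_pos], hθ2⟩ h1
  have hleft := sq_mul_integral_norm_sq_le_of_tan hf hf' (k := k) (c := a) hy.1 (by
    intro x hx
    have h0 := mul_nonneg hk0 (sub_nonneg.2 hx.1)
    have h1 : k * (x - a) ≤ θ :=
      hkL ▸ mul_le_mul_of_nonneg_left (by linarith [hx.2, hy.2]) hk0
    exact Real.cos_pos_of_mem_Ioo ⟨by linarith [Real.pi_pos], by linarith⟩)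
  have hright := sq_mul_integral_norm_sq_le_of_tan hf hf' (k := k) (c := b) hy.2 (by
    intro x hx
    have h0 := mul_nonneg hk0 (sub_nonneg.2 hx.2)
    have h1 : k * (b - x) ≤ θ :=
      hkL ▸ mul_le_mul_of_nonneg_left (by linarith [hx.1, hy.1]) hk0
    have h2 : k * (x - b) = - (k * (b - x)) := by ring
    exact Real.cos_pos_of_mem_Ioo ⟨by linarith [Real.pi_pos], by linarith [Real.pi_pos]⟩)
  have hsplit : ∀ g : ℝ → ℂ, Continuous g → (∫ x in a..y, ‖g x‖ ^ 2) + (∫ x in y..b, ‖g x‖ ^ 2)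
      = ∫ x in a..b, ‖g x‖ ^ 2 := fun g hg =>
    intervalIntegral.integral_add_adjacent_intervals
      (Continuous.intervalIntegrable (by fun_prop) _ _)
      (Continuous.intervalIntegrable (by fun_prop) _ _)
  have h3 : k * (y - b) = - (k * (b - y)) := by ring
  simp only [sub_self, mul_zero, Real.tan_zero, zero_mul, sub_zero, zero_sub, h3,
    Real.tan_neg] at hleft hright
  have b1 := mul_le_mul_of_nonneg_right (hle (y - a) (by linarith [hy.1]) (by linarith [hy.2]))
    (sq_nonneg ‖f y‖)
  have b2 := mul_le_mul_of_nonneg_right (hle (b - y) (by linarith [hy.2]) (by linarith [hy.1]))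
    (sq_nonneg ‖f y‖)
  rw [← hsplit f hfc, ← hsplit f' hf']
  nlinarith

theorem norm_sq_le_add_integral {f f' : ℝ → ℂ} (hf : ∀ x, HasDerivAt f (f' x) x)
    (hf' : Continuous f') {a b x y ε : ℝ} (hx : x ∈ Set.Icc a b) (hy : y ∈ Set.Icc a b)
    (hε : 0 < ε) :
    ‖f x‖ ^ 2 ≤ ‖f y‖ ^ 2 + ε * (∫ s in a..b, ‖f s‖ ^ 2) + ε⁻¹ * ∫ s in a..b, ‖f' s‖ ^ 2 := by
  have hfc : Continuous f := continuous_iff_continuousAt.2 fun x => (hf x).continuousAt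
  have hab : a ≤ b := hx.1.trans hx.2
  have h1 := intervalIntegral.integral_eq_sub_of_hasDerivAt (a := y) (b := x)
    (fun s _ => (hf s).norm_sq) (Continuous.intervalIntegrable (by fun_prop) _ _)
  have h2 : (∫ s in y..x, 2 * inner ℝ (f s) (f' s))
      ≤ ∫ s in a..b, ε * ‖f s‖ ^ 2 + ε⁻¹ * ‖f' s‖ ^ 2 := by
    have hpt : ∀ s, ‖2 * inner ℝ (f s) (f' s)‖ ≤ ε * ‖f s‖ ^ 2 + ε⁻¹ * ‖f' s‖ ^ 2 := by
      intro s
      rw [norm_mul, Real.norm_eq_abs, Real.norm_eq_abs, abs_two]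
      have h3 := abs_real_inner_le_norm (f s) (f' s)
      have h4 : 0 ≤ ε⁻¹ * (ε * ‖f s‖ - ‖f' s‖) ^ 2 := by positivity
      have h5 : ε⁻¹ * (ε * ‖f s‖ - ‖f' s‖) ^ 2
          = ε * ‖f s‖ ^ 2 + ε⁻¹ * ‖f' s‖ ^ 2 - 2 * (‖f s‖ * ‖f' s‖) := by
        field_simp; ring
      linarith
    have hcont : Continuous fun s => ε * ‖f s‖ ^ 2 + ε⁻¹ * ‖f' s‖ ^ 2 := by fun_prop
    calc _ ≤ ‖∫ s in y..x, 2 * inner ℝ (f s) (f' s)‖ := Real.le_norm_self _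
      _ ≤ ∫ s in Set.uIoc y x, ‖2 * inner ℝ (f s) (f' s)‖ :=
        intervalIntegral.norm_integral_le_integral_norm_uIoc
      _ ≤ ∫ s in Set.uIoc y x, ε * ‖f s‖ ^ 2 + ε⁻¹ * ‖f' s‖ ^ 2 := by
        refine setIntegral_mono ?_ ?_ hpt
        · exact (Continuous.integrableOn_uIcc (by fun_prop)).mono_set Set.uIoc_subset_uIcc
        · exact hcont.integrableOn_uIcc.mono_set Set.uIoc_subset_uIcc
      _ ≤ _ := by
        rw [intervalIntegral.integral_of_le hab]
        refine setIntegral_mono_set ?_ ?_ ?_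
        · exact (hcont.integrableOn_Icc).mono_set Set.Ioc_subset_Icc_self
        · exact Filter.Eventually.of_forall fun s => by positivity
        · refine (Set.Ioc_subset_Ioc ?_ ?_).eventuallyLE
          · exact le_min hy.1 hx.1
          · exact max_le hy.2 hx.2
  rw [intervalIntegral.integral_add (Continuous.intervalIntegrable (by fun_prop) _ _)
    (Continuous.intervalIntegrable (by fun_prop) _ _), h1, intervalIntegral.integral_const_mul,
    intervalIntegral.integral_const_mul] at h2
  linarith

theorem measurePreserving_of_coordinates {ι κ : Type*} [Fintype ι] [Fintype κ] (i₀ : ι)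
    (e : κ → ι) (he : Function.Injective e) (hne : ∀ k, e k ≠ i₀)
    (hsurj : ∀ i, i ≠ i₀ → ∃ k, e k = i) (g : ℝ × (κ → ℝ) → ι → ℝ)
    (h0 : ∀ p, g p i₀ = p.1) (h1 : ∀ p k, g p (e k) = p.2 k) :
    MeasurePreserving g := by
  classical
  have hg : Measurable g := by
    refine measurable_pi_iff.2 fun i => ?_
    by_cases hi : i = i₀
    · subst hi; simp only [h0]; exact measurable_fst
    · obtain ⟨k, rfl⟩ := hsurj i hi
      simp only [h1]; exact (measurable_pi_apply k).comp measurable_snd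
  have huniv : (Finset.univ : Finset ι) = insert i₀ (Finset.univ.image e) := by
    ext i
    by_cases hi : i = i₀
    · simp [hi]
    · simpa [hi] using hsurj i hi
  refine ⟨hg, ?_⟩
  refine (Measure.pi_eq fun s hs => ?_).symm
  rw [Measure.map_apply hg (MeasurableSet.univ_pi hs)]
  have hpre : g ⁻¹' (Set.univ.pi s) = s i₀ ×ˢ Set.univ.pi fun k => s (e k) := by
    ext p
    simp only [Set.mem_preimage, Set.mem_pi, Set.mem_univ, true_imp_iff, Set.mem_prod]
    constructor
    · exact fun h => ⟨h0 p ▸ h i₀, fun k => h1 p k ▸ h (e k)⟩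
    · rintro ⟨h, h'⟩ i
      by_cases hi : i = i₀
      · subst hi; rw [h0]; exact h
      · obtain ⟨k, rfl⟩ := hsurj i hi
        rw [h1]; exact h' k
  rw [hpre, Measure.volume_eq_prod, Measure.prod_prod, volume_pi_pi, huniv,
    Finset.prod_insert (by simpa using hne), Finset.prod_image (fun _ _ _ _ h => he h)]

theorem MeasureTheory.MeasurePreserving.integral_comp_of_integrable {α β : Type*}
    [MeasurableSpace α] [MeasurableSpace β] {μ : Measure α} {ν : Measure β} {g : α → β}
    (hg : MeasurePreserving g μ ν) {F : β → ℝ} (hF : Integrable F ν) : ∫ x, F (g x) ∂μ = ∫ y, F y ∂ν := by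
  rw [← hg.map_eq] at hF ⊢
  exact (integral_map hg.measurable.aemeasurable hF.aestronglyMeasurable).symm

/-- The configuration whose `j`-th coordinate is `x` and whose other coordinates are `z`. -/
def insertCoord {N : ℕ} (j : Fin N) (x : ℝ) (z : {k : Fin N // k ≠ j} → ℝ) : Fin N → ℝ :=
  fun k => if h : k = j then x else z ⟨k, h⟩

section insertCoord

variable {N : ℕ} (j : Fin N)

@[simp]
theorem insertCoord_self (x : ℝ) (z : {k : Fin N // k ≠ j} → ℝ) : insertCoord j x z j = x := by
  simp [insertCoord]

@[simp]
theorem insertCoord_coe (x : ℝ) (z : {k : Fin N // k ≠ j} → ℝ) (k : {k : Fin N // k ≠ j}) :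
    insertCoord j x z k = z k := by
  simp [insertCoord, k.2]

theorem continuous_insertCoord :
    Continuous fun p : ℝ × ({k : Fin N // k ≠ j} → ℝ) => insertCoord j p.1 p.2 := by
  refine continuous_pi fun k => ?_
  by_cases hk : k = j
  · subst hk; simpa using continuous_fst
  · have := fun p : ℝ × ({k : Fin N // k ≠ j} → ℝ) => insertCoord_coe j p.1 p.2 ⟨k, hk⟩
    simp only at this
    simp only [this]
    fun_prop

theorem isClosedEmbedding_insertCoord {u : ({k : Fin N // k ≠ j} → ℝ) → ℝ} (hu : Continuous u) :
    Topology.IsClosedEmbedding fun z => insertCoord j (u z) z :=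
  Function.LeftInverse.isClosedEmbedding
    (f := fun (x : Fin N → ℝ) (k : {k : Fin N // k ≠ j}) => x k)
    (fun z => funext fun k => insertCoord_coe j (u z) z k) (by fun_prop)
    ((continuous_insertCoord j).comp (hu.prodMk continuous_id))

theorem hasDerivAt_insertCoord (x : ℝ) (z : {k : Fin N // k ≠ j} → ℝ) :
    HasDerivAt (fun s => insertCoord j s z) (Pi.single j 1) x := by
  refine hasDerivAt_pi.2 fun k => ?_
  by_cases hk : k = j
  · subst hk; simpa using hasDerivAt_id' x
  · simpa [insertCoord, hk] using hasDerivAt_const x (z ⟨k, hk⟩)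

theorem measurePreserving_insertCoord {Q : Set ℝ} (hQ : MeasurableSet Q) :
    MeasurePreserving (fun p : ℝ × ({k : Fin N // k ≠ j} → ℝ) => insertCoord j p.1 p.2)
      ((volume.restrict Q).prod volume) (volume.restrict {x : Fin N → ℝ | x j ∈ Q}) := by
  have h := (measurePreserving_of_coordinates j (fun k : {k : Fin N // k ≠ j} => (k : Fin N))
    Subtype.val_injective (fun k => k.2) (fun i hi => ⟨⟨i, hi⟩, rfl⟩)
    (fun p : ℝ × ({k : Fin N // k ≠ j} → ℝ) => insertCoord j p.1 p.2)
    (fun p => insertCoord_self j _ _)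
    (fun p k => insertCoord_coe j _ _ k)).restrict_preimage
      (s := {x : Fin N → ℝ | x j ∈ Q}) (measurable_pi_apply j hQ)
  have hpre : (fun p : ℝ × ({k : Fin N // k ≠ j} → ℝ) => insertCoord j p.1 p.2) ⁻¹'
      {x : Fin N → ℝ | x j ∈ Q} = Q ×ˢ Set.univ := by
    ext p; simp
  rwa [hpre, Measure.volume_eq_prod, ← Measure.prod_restrict, Measure.restrict_univ] at h

variable {F : (Fin N → ℝ) → ℝ} {Q : Set ℝ}

theorem integrable_insertCoord_prod (hF : Integrable F) (hQ : MeasurableSet Q) :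
    Integrable (fun p : ℝ × ({k : Fin N // k ≠ j} → ℝ) => F (insertCoord j p.1 p.2))
      ((volume.restrict Q).prod volume) :=
  (measurePreserving_insertCoord j hQ).integrable_comp_of_integrable hF.restrict

theorem integrable_setIntegral_insertCoord (hF : Integrable F) (hQ : MeasurableSet Q) :
    Integrable fun z : {k : Fin N // k ≠ j} → ℝ => ∫ x in Q, F (insertCoord j x z) :=
  (integrable_insertCoord_prod j hF hQ).integral_prod_right

theorem integrable_integral_insertCoord (hF : Integrable F) :
    Integrable fun x : ℝ => ∫ z, F (insertCoord j x z) := by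
  simpa using (integrable_insertCoord_prod j hF MeasurableSet.univ).integral_prod_left

theorem integral_setIntegral_insertCoord (hF : Integrable F) (hQ : MeasurableSet Q) :
    ∫ z : {k : Fin N // k ≠ j} → ℝ, ∫ x in Q, F (insertCoord j x z)
      = ∫ x in {x : Fin N → ℝ | x j ∈ Q}, F x := by
  rw [← MeasurePreserving.integral_comp_of_integrable (measurePreserving_insertCoord j hQ)
    hF.restrict, integral_prod_symm _ (integrable_insertCoord_prod j hF hQ)]

theorem setIntegral_integral_insertCoord (hF : Integrable F) (hQ : MeasurableSet Q) :
    ∫ x in Q, ∫ z : {k : Fin N // k ≠ j} → ℝ, F (insertCoord j x z)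
      = ∫ x in {x : Fin N → ℝ | x j ∈ Q}, F x := by
  rw [← MeasurePreserving.integral_comp_of_integrable (measurePreserving_insertCoord j hQ)
    hF.restrict, integral_prod _ (integrable_insertCoord_prod j hF hQ)]

end insertCoord

section density

variable {N : ℕ} {ψ : (Fin N → ℝ) → ℂ}

theorem densityAt_eq (ψ : (Fin N → ℝ) → ℂ) (j : Fin N) (y : ℝ) :
    densityAt ψ j y = ∫ z, ‖ψ (insertCoord j y z)‖ ^ 2 := rfl

theorem densityAt_eq_of_symmetric
    (hsym : ∀ (σ : Equiv.Perm (Fin N)) (x : Fin N → ℝ), ψ (x ∘ σ) = ψ x) (i j : Fin N) (y : ℝ) :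
    densityAt ψ i y = densityAt ψ j y := by
  let e : {k : Fin N // k ≠ j} ≃ {k : Fin N // k ≠ i} :=
    (Equiv.swap j i).subtypeEquiv fun k => by
      rw [← not_iff_not]
      simp only [not_not]
      rw [← Equiv.apply_eq_iff_eq (Equiv.swap j i) (x := k), Equiv.swap_apply_left]
  rw [densityAt_eq, densityAt_eq,
    ← (volume_measurePreserving_piCongrLeft (fun _ => ℝ) e).integral_comp']
  refine integral_congr_ae (Filter.Eventually.of_forall fun z => ?_)
  simp only
  rw [← hsym (Equiv.swap j i)]
  congr 3
  funext k
  by_cases hk : k = j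
  · subst hk; simp
  · have h1 := insertCoord_coe j y z ⟨k, hk⟩
    have h2 := insertCoord_coe i y (MeasurableEquiv.piCongrLeft (fun _ => ℝ) e z) (e ⟨k, hk⟩)
    rw [MeasurableEquiv.piCongrLeft_apply_apply] at h2
    exact h2.trans h1.symm

theorem integrable_norm_sq_comp {α : Type*} [TopologicalSpace α] [MeasurableSpace α]
    [OpensMeasurableSpace α] {μ : Measure α} [IsFiniteMeasureOnCompacts μ]
    {X : Type*} [TopologicalSpace X] {φ : X → ℂ} (hφ : Continuous φ) (hcs : HasCompactSupport φ)
    {g : α → X} (hg : Topology.IsClosedEmbedding g) :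
    Integrable (fun z => ‖φ (g z)‖ ^ 2) μ := by
  refine Continuous.integrable_of_hasCompactSupport
    ((hφ.comp hg.continuous).norm.pow 2) ?_
  exact (hcs.comp_isClosedEmbedding hg).comp_left (g := fun c : ℂ => ‖c‖ ^ 2) (by simp)

theorem continuous_partialDeriv (hψ : ContDiff ℝ (⊤ : ℕ∞) ψ) (j : Fin N) :
    Continuous fun x => fderiv ℝ ψ x (Pi.single j 1) :=
  (hψ.continuous_fderiv (by simp)).clm_apply continuous_const

theorem integrable_norm_sq (hψ : ContDiff ℝ (⊤ : ℕ∞) ψ) (hcs : HasCompactSupport ψ) :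
    Integrable fun x => ‖ψ x‖ ^ 2 :=
  integrable_norm_sq_comp hψ.continuous hcs Topology.IsClosedEmbedding.id

theorem integrable_norm_sq_partialDeriv (hψ : ContDiff ℝ (⊤ : ℕ∞) ψ) (hcs : HasCompactSupport ψ)
    (j : Fin N) : Integrable fun x => ‖fderiv ℝ ψ x (Pi.single j 1)‖ ^ 2 :=
  integrable_norm_sq_comp (continuous_partialDeriv hψ j) (hcs.fderiv_apply ℝ _)
    Topology.IsClosedEmbedding.id

theorem integrable_norm_sq_insertCoord (hψ : ContDiff ℝ (⊤ : ℕ∞) ψ) (hcs : HasCompactSupport ψ)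
    (j : Fin N) {u : ({k : Fin N // k ≠ j} → ℝ) → ℝ} (hu : Continuous u) :
    Integrable fun z => ‖ψ (insertCoord j (u z) z)‖ ^ 2 :=
  integrable_norm_sq_comp hψ.continuous hcs (isClosedEmbedding_insertCoord j hu)

theorem hasDerivAt_comp_insertCoord (hψ : ContDiff ℝ (⊤ : ℕ∞) ψ) (j : Fin N)
    (z : {k : Fin N // k ≠ j} → ℝ) (x : ℝ) :
    HasDerivAt (fun s => ψ (insertCoord j s z))
      (fderiv ℝ ψ (insertCoord j x z) (Pi.single j 1)) x :=
  ((hψ.differentiable (by simp) _).hasFDerivAt).comp_hasDerivAt x (hasDerivAt_insertCoord j x z)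

theorem continuous_partialDeriv_insertCoord (hψ : ContDiff ℝ (⊤ : ℕ∞) ψ) (j : Fin N)
    (z : {k : Fin N // k ≠ j} → ℝ) :
    Continuous fun s => fderiv ℝ ψ (insertCoord j s z) (Pi.single j 1) :=
  (continuous_partialDeriv hψ j).comp
    ((continuous_insertCoord j).comp (continuous_id.prodMk continuous_const))

theorem densityAt_le_add (hψ : ContDiff ℝ (⊤ : ℕ∞) ψ) (hcs : HasCompactSupport ψ) (j : Fin N)
    {a b x y ε : ℝ} (hx : x ∈ Set.Icc a b) (hy : y ∈ Set.Icc a b) (hε : 0 < ε) :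
    densityAt ψ j x ≤ densityAt ψ j y + ε * (∫ s in Set.Ioc a b, densityAt ψ j s)
      + ε⁻¹ * ∫ x in {x : Fin N → ℝ | x j ∈ Set.Ioc a b},
          ‖fderiv ℝ ψ x (Pi.single j 1)‖ ^ 2 := by
  have hab : a ≤ b := hx.1.trans hx.2
  have hI := integrable_norm_sq hψ hcs
  have hD := integrable_norm_sq_partialDeriv hψ hcs j
  simp only [densityAt_eq]
  rw [setIntegral_integral_insertCoord j hI measurableSet_Ioc,
    ← integral_setIntegral_insertCoord j hI measurableSet_Ioc,
    ← integral_setIntegral_insertCoord j hD measurableSet_Ioc, ← integral_const_mul,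
    ← integral_const_mul]
  have i1 := integrable_norm_sq_insertCoord hψ hcs j (continuous_const (y := y))
  have hQ : MeasurableSet (Set.Ioc a b) := measurableSet_Ioc
  have i2 := (integrable_setIntegral_insertCoord j hI hQ).const_mul ε
  have i3 := (integrable_setIntegral_insertCoord j hD hQ).const_mul ε⁻¹
  have i12 : Integrable fun z => ‖ψ (insertCoord j y z)‖ ^ 2
    + ε * ∫ x in Set.Ioc a b, ‖ψ (insertCoord j x z)‖ ^ 2 := i1.add i2
  rw [← integral_add i1 i2, ← integral_add i12 i3]
  refine integral_mono (integrable_norm_sq_insertCoord hψ hcs j continuous_const) (i12.add i3)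
    fun z => ?_
  have h := norm_sq_le_add_integral (hasDerivAt_comp_insertCoord hψ j z)
    (continuous_partialDeriv_insertCoord hψ j z) hx hy hε
  rwa [intervalIntegral.integral_of_le hab, intervalIntegral.integral_of_le hab] at h

theorem exclusion_at_coordinate (hψ : ContDiff ℝ (⊤ : ℕ∞) ψ) (hcs : HasCompactSupport ψ)
    (j : Fin N) {a b θ η : ℝ} (hη : 0 ≤ η) (hab : a < b)
    (hθ : 0 ≤ θ) (hθ2 : θ < Real.pi / 2) (hθη : θ * Real.tan θ ≤ η * (b - a)) :
    (θ / (b - a)) ^ 2 * (∫ x in {x : Fin N → ℝ | x j ∈ Set.Ioc a b},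
        {x : Fin N → ℝ | ∃ k : {k : Fin N // k ≠ j}, x k ∈ Set.Ioc a b}.indicator
          (fun x => ‖ψ x‖ ^ 2) x)
      ≤ (∫ x in {x : Fin N → ℝ | x j ∈ Set.Ioc a b}, ‖fderiv ℝ ψ x (Pi.single j 1)‖ ^ 2)
        + 2 * η * ∑ k : {k : Fin N // k ≠ j},
            ∫ z in {z : {k : Fin N // k ≠ j} → ℝ | z k ∈ Set.Ioc a b},
              ‖ψ (insertCoord j (z k) z)‖ ^ 2 := by
  have hB : MeasurableSet {x : Fin N → ℝ | ∃ k : {k : Fin N // k ≠ j}, x k ∈ Set.Ioc a b} := by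
    rw [Set.ofPred_exists]
    exact MeasurableSet.iUnion fun k => measurable_pi_apply (k : Fin N) measurableSet_Ioc
  have hI := (integrable_norm_sq hψ hcs).indicator hB
  have hD := integrable_norm_sq_partialDeriv hψ hcs j
  have hk : ∀ k : {k : Fin N // k ≠ j},
      MeasurableSet {z : {k : Fin N // k ≠ j} → ℝ | z k ∈ Set.Ioc a b} := fun k =>
    measurable_pi_apply k measurableSet_Ioc
  have hJ : ∀ k : {k : Fin N // k ≠ j}, Integrable
      ({z : {k : Fin N // k ≠ j} → ℝ | z k ∈ Set.Ioc a b}.indicator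
        fun z => ‖ψ (insertCoord j (z k) z)‖ ^ 2) := fun k =>
    (integrable_norm_sq_insertCoord hψ hcs j (continuous_apply k)).indicator (hk k)
  have hJs := (integrable_finsetSum Finset.univ fun k _ => hJ k).const_mul (2 * η)
  rw [← integral_setIntegral_insertCoord j hI measurableSet_Ioc,
    ← integral_setIntegral_insertCoord j hD measurableSet_Ioc, ← integral_const_mul]
  simp only [← integral_indicator (hk _)]
  rw [← integral_finsetSum _ fun k _ => hJ k, ← integral_const_mul,
    ← integral_add (integrable_setIntegral_insertCoord j hD measurableSet_Ioc) hJs]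
  refine integral_mono ((integrable_setIntegral_insertCoord j hI measurableSet_Ioc).const_mul _)
    ((integrable_setIntegral_insertCoord j hD measurableSet_Ioc).add hJs) fun z => ?_
  simp only
  have hnn : ∀ k ∈ Finset.univ, 0 ≤
      {z : {k : Fin N // k ≠ j} → ℝ | z k ∈ Set.Ioc a b}.indicator
        (fun z => ‖ψ (insertCoord j (z k) z)‖ ^ 2) z := fun k _ =>
    Set.indicator_nonneg (fun _ _ => by positivity) _
  by_cases hz : ∃ k : {k : Fin N // k ≠ j}, z k ∈ Set.Ioc a b
  · obtain ⟨k, hkz⟩ := hz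
    have h := pinned_interval_inequality (hasDerivAt_comp_insertCoord hψ j z)
      (continuous_partialDeriv_insertCoord hψ j z) hab (Set.Ioc_subset_Icc_self hkz) hθ hθ2 hθη
    rw [intervalIntegral.integral_of_le hab.le, intervalIntegral.integral_of_le hab.le] at h
    have hmem : ∀ x, insertCoord j x z ∈
        {x : Fin N → ℝ | ∃ k : {k : Fin N // k ≠ j}, x k ∈ Set.Ioc a b} := fun x =>
      ⟨k, by simpa using hkz⟩
    simp only [Set.indicator_of_mem (hmem _)]
    refine h.trans ?_
    gcongr
    refine le_trans ?_ (Finset.single_le_sum hnn (Finset.mem_univ k))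
    rw [Set.indicator_of_mem (s := {z : {k : Fin N // k ≠ j} → ℝ | z k ∈ Set.Ioc a b}) hkz]
  · have hmem : ∀ x, insertCoord j x z ∉
        {x : Fin N → ℝ | ∃ k : {k : Fin N // k ≠ j}, x k ∈ Set.Ioc a b} := fun x hx => by
      obtain ⟨k, hk⟩ := hx
      exact hz ⟨k, by simpa using hk⟩
    simp only [Set.indicator_of_notMem (hmem _), integral_zero, mul_zero]
    have := Finset.sum_nonneg hnn
    have : 0 ≤ ∫ x in Set.Ioc a b, ‖fderiv ℝ ψ (insertCoord j x z) (Pi.single j 1)‖ ^ 2 :=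
      integral_nonneg fun _ => by positivity
    positivity

/-- The sum of the one-particle densities of all coordinates. -/
noncomputable def totalDensity (ψ : (Fin N → ℝ) → ℂ) (y : ℝ) : ℝ := ∑ j, densityAt ψ j y

/-- The free kinetic energy (without the factor `1/2`) of the particles located in `Q`. -/
noncomputable def kineticOn (ψ : (Fin N → ℝ) → ℂ) (Q : Set ℝ) : ℝ :=
  ∑ j, ∫ x in {x : Fin N → ℝ | x j ∈ Q}, ‖fderiv ℝ ψ x (Pi.single j 1)‖ ^ 2

/-- The contact energy of the ordered pairs of particles that meet in `Q`. -/
noncomputable def contactOn (ψ : (Fin N → ℝ) → ℂ) (Q : Set ℝ) : ℝ :=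
  ∑ j, ∑ k : {k : Fin N // k ≠ j},
    ∫ z in {z : {k : Fin N // k ≠ j} → ℝ | z k ∈ Q}, ‖ψ (insertCoord j (z k) z)‖ ^ 2

theorem densityAt_nonneg (ψ : (Fin N → ℝ) → ℂ) (j : Fin N) (y : ℝ) : 0 ≤ densityAt ψ j y :=
  integral_nonneg fun _ => by positivity

theorem totalDensity_nonneg (ψ : (Fin N → ℝ) → ℂ) (y : ℝ) : 0 ≤ totalDensity ψ y :=
  Finset.sum_nonneg fun _ _ => densityAt_nonneg ψ _ y

theorem kineticOn_nonneg (ψ : (Fin N → ℝ) → ℂ) (Q : Set ℝ) : 0 ≤ kineticOn ψ Q :=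
  Finset.sum_nonneg fun _ _ => integral_nonneg fun _ => by positivity

theorem contactOn_nonneg (ψ : (Fin N → ℝ) → ℂ) (Q : Set ℝ) : 0 ≤ contactOn ψ Q :=
  Finset.sum_nonneg fun _ _ => Finset.sum_nonneg fun _ _ => integral_nonneg fun _ => by positivity

theorem integrable_densityAt (hψ : ContDiff ℝ (⊤ : ℕ∞) ψ) (hcs : HasCompactSupport ψ)
    (j : Fin N) : Integrable (densityAt ψ j) :=
  integrable_integral_insertCoord j (integrable_norm_sq hψ hcs)

theorem integrable_totalDensity (hψ : ContDiff ℝ (⊤ : ℕ∞) ψ) (hcs : HasCompactSupport ψ) :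
    Integrable (totalDensity ψ) :=
  integrable_finsetSum _ fun j _ => integrable_densityAt hψ hcs j

theorem setIntegral_totalDensity (hψ : ContDiff ℝ (⊤ : ℕ∞) ψ) (hcs : HasCompactSupport ψ)
    {Q : Set ℝ} (hQ : MeasurableSet Q) :
    ∫ x in Q, totalDensity ψ x = ∑ j, ∫ x in {x : Fin N → ℝ | x j ∈ Q}, ‖ψ x‖ ^ 2 := by
  unfold totalDensity
  rw [integral_finsetSum _ fun j _ => (integrable_densityAt hψ hcs j).restrict]
  exact Finset.sum_congr rfl fun j _ =>
    setIntegral_integral_insertCoord j (integrable_norm_sq hψ hcs) hQ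

theorem integral_totalDensity (hψ : ContDiff ℝ (⊤ : ℕ∞) ψ) (hcs : HasCompactSupport ψ)
    (hnorm : ∫ x : Fin N → ℝ, ‖ψ x‖ ^ 2 = 1) : ∫ x, totalDensity ψ x = N := by
  have h := setIntegral_totalDensity hψ hcs MeasurableSet.univ
  simpa [hnorm] using h

theorem kineticOn_union (hψ : ContDiff ℝ (⊤ : ℕ∞) ψ) (hcs : HasCompactSupport ψ) {Q R : Set ℝ}
    (hR : MeasurableSet R) (hQR : Disjoint Q R) :
    kineticOn ψ (Q ∪ R) = kineticOn ψ Q + kineticOn ψ R := by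
  unfold kineticOn
  rw [← Finset.sum_add_distrib]
  refine Finset.sum_congr rfl fun j _ => ?_
  have hI := integrable_norm_sq_partialDeriv hψ hcs j
  exact setIntegral_union (hQR.preimage fun x : Fin N → ℝ => x j) (measurable_pi_apply j hR)
    hI.integrableOn hI.integrableOn

theorem contactOn_union (hψ : ContDiff ℝ (⊤ : ℕ∞) ψ) (hcs : HasCompactSupport ψ) {Q R : Set ℝ}
    (hR : MeasurableSet R) (hQR : Disjoint Q R) :
    contactOn ψ (Q ∪ R) = contactOn ψ Q + contactOn ψ R := by
  unfold contactOn
  simp only [← Finset.sum_add_distrib]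
  refine Finset.sum_congr rfl fun j _ => Finset.sum_congr rfl fun k _ => ?_
  have hI := integrable_norm_sq_insertCoord hψ hcs j (continuous_apply k)
  exact setIntegral_union (hQR.preimage fun z : {k : Fin N // k ≠ j} → ℝ => z k)
    (measurable_pi_apply k hR) hI.integrableOn hI.integrableOn

theorem kineticOn_le_univ (hψ : ContDiff ℝ (⊤ : ℕ∞) ψ) (hcs : HasCompactSupport ψ) {Q : Set ℝ}
    (hQ : MeasurableSet Q) : kineticOn ψ Q ≤ kineticOn ψ Set.univ := by
  rw [← Set.union_compl_self Q, kineticOn_union hψ hcs hQ.compl disjoint_compl_right]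
  exact le_add_of_nonneg_right (kineticOn_nonneg ψ _)

theorem contactOn_le_univ (hψ : ContDiff ℝ (⊤ : ℕ∞) ψ) (hcs : HasCompactSupport ψ) {Q : Set ℝ}
    (hQ : MeasurableSet Q) : contactOn ψ Q ≤ contactOn ψ Set.univ := by
  rw [← Set.union_compl_self Q, contactOn_union hψ hcs hQ.compl disjoint_compl_right]
  exact le_add_of_nonneg_right (contactOn_nonneg ψ _)

theorem totalDensity_le_add (hψ : ContDiff ℝ (⊤ : ℕ∞) ψ) (hcs : HasCompactSupport ψ)
    {a b x y ε : ℝ} (hx : x ∈ Set.Icc a b) (hy : y ∈ Set.Icc a b) (hε : 0 < ε) :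
    totalDensity ψ x ≤ totalDensity ψ y + ε * (∫ s in Set.Ioc a b, totalDensity ψ s)
      + ε⁻¹ * kineticOn ψ (Set.Ioc a b) := by
  have h := Finset.sum_le_sum fun j (_ : j ∈ Finset.univ) => densityAt_le_add hψ hcs j hx hy hε
  rw [Finset.sum_add_distrib, Finset.sum_add_distrib, ← Finset.mul_sum, ← Finset.mul_sum] at h
  unfold totalDensity kineticOn
  rwa [integral_finsetSum _ fun j _ => (integrable_densityAt hψ hcs j).restrict]

/-- Optimizing the bound `A + ε * m + K / ε` in `ε`. -/
theorem le_add_mul_sqrt_of_forall_pos {t A m K : ℝ} (hm : 0 ≤ m) (hK : 0 ≤ K)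
    (h : ∀ ε > 0, t ≤ A + ε * m + ε⁻¹ * K) : t ≤ A + (m + 1) * √K := by
  refine le_of_forall_pos_le_add fun δ hδ => ?_
  have hs := Real.sqrt_nonneg K
  have hε : 0 < √K + δ / (m + 1) := by positivity
  have h1 := h _ hε
  have h2 : (√K + δ / (m + 1))⁻¹ * K ≤ √K := by
    rw [inv_mul_le_iff₀ hε]
    nlinarith [Real.sq_sqrt hK, mul_nonneg (div_nonneg hδ.le (by linarith : 0 ≤ m + 1)) hs]
  have h3 : δ / (m + 1) * m ≤ δ := by
    rw [div_mul_eq_mul_div, div_le_iff₀ (by linarith)]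
    nlinarith
  nlinarith

theorem totalDensity_le_of_interval (hψ : ContDiff ℝ (⊤ : ℕ∞) ψ) (hcs : HasCompactSupport ψ)
    {a b x : ℝ} (hab : a < b) (hx : x ∈ Set.Icc a b) :
    totalDensity ψ x ≤ (∫ s in Set.Ioc a b, totalDensity ψ s) / (b - a)
      + ((∫ s in Set.Ioc a b, totalDensity ψ s) + 1) * √(kineticOn ψ (Set.Ioc a b)) := by
  refine le_add_mul_sqrt_of_forall_pos (integral_nonneg fun s => totalDensity_nonneg ψ s)
    (kineticOn_nonneg ψ _) fun ε hε => ?_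
  set m := ∫ s in Set.Ioc a b, totalDensity ψ s with hm
  set K := kineticOn ψ (Set.Ioc a b)
  have hL : 0 < b - a := sub_pos.2 hab
  have h : ∫ _ in Set.Ioc a b, (totalDensity ψ x - (ε * m + ε⁻¹ * K)) ≤ m := by
    refine setIntegral_mono_on (by simp) (integrable_totalDensity hψ hcs).integrableOn
      measurableSet_Ioc fun y hy => ?_
    have := totalDensity_le_add hψ hcs hx (Set.Ioc_subset_Icc_self hy) hε
    linarith
  rw [setIntegral_const, Real.volume_real_Ioc_of_le hab.le, smul_eq_mul, ← le_div_iff₀' hL] at h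
  linarith

theorem totalDensity_le_of_eq_zero (hψ : ContDiff ℝ (⊤ : ℕ∞) ψ) (hcs : HasCompactSupport ψ)
    (hnorm : ∫ x : Fin N → ℝ, ‖ψ x‖ ^ 2 = 1) {y : ℝ} (hy : totalDensity ψ y = 0) (x : ℝ) :
    totalDensity ψ x ≤ (N + 1) * √(kineticOn ψ Set.univ) := by
  have h : totalDensity ψ x ≤ 0 + (N + 1) * √(kineticOn ψ Set.univ) := by
    refine le_add_mul_sqrt_of_forall_pos (by positivity) (kineticOn_nonneg ψ _) fun ε hε => ?_
    have h1 := totalDensity_le_add hψ hcs (a := min x y) (b := max x y)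
      ⟨min_le_left _ _, le_max_left _ _⟩ ⟨min_le_right _ _, le_max_right _ _⟩ hε
    refine h1.trans ?_
    rw [hy]
    gcongr
    · rw [← integral_totalDensity hψ hcs hnorm]
      exact setIntegral_le_integral (integrable_totalDensity hψ hcs)
        (Filter.Eventually.of_forall fun s => totalDensity_nonneg ψ s)
    · exact kineticOn_le_univ hψ hcs measurableSet_Ioc
  simpa using h

theorem sum_indicator_sub_one_le (Q : Set ℝ) (x : Fin N → ℝ) :
    ∑ j, {x : Fin N → ℝ | x j ∈ Q}.indicator (fun _ => (1 : ℝ)) x - 1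
      ≤ ∑ j, {x : Fin N → ℝ | x j ∈ Q}.indicator
        ({x : Fin N → ℝ | ∃ k : {k : Fin N // k ≠ j}, x k ∈ Q}.indicator fun _ => (1 : ℝ)) x := by
  classical
  simp only [Set.indicator_apply, Set.mem_ofPred_eq]
  by_cases h : ∃ j k : Fin N, k ≠ j ∧ x j ∈ Q ∧ x k ∈ Q
  · obtain ⟨i, l, hil, hi, hl⟩ := h
    refine le_trans (sub_le_self _ zero_le_one) (Finset.sum_le_sum fun j _ => ?_)
    have : ∃ k : {k : Fin N // k ≠ j}, x k ∈ Q := by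
      by_cases hji : j = i
      · exact ⟨⟨l, hji ▸ hil⟩, hl⟩
      · exact ⟨⟨i, Ne.symm hji⟩, hi⟩
    simp [this]
  · have h1 : ∑ j, (if x j ∈ Q then (1 : ℝ) else 0) ≤ 1 := by
      rw [Finset.sum_boole]
      have : (Finset.univ.filter fun j => x j ∈ Q).card ≤ 1 := by
        refine Finset.card_le_one.2 fun i hi l hl => ?_
        by_contra hne
        exact h ⟨i, l, Ne.symm hne, by simpa using hi, by simpa using hl⟩
      exact_mod_cast this
    refine le_trans (sub_nonpos.2 h1) (Finset.sum_nonneg fun j _ => ?_)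
    split_ifs <;> norm_num

/-- Local exclusion: an interval carrying mass larger than one has positive energy. -/
theorem exclusion_on_interval (hψ : ContDiff ℝ (⊤ : ℕ∞) ψ) (hcs : HasCompactSupport ψ)
    (hnorm : ∫ x : Fin N → ℝ, ‖ψ x‖ ^ 2 = 1) {a b θ η : ℝ} (hη : 0 ≤ η) (hab : a < b)
    (hθ : 0 ≤ θ) (hθ2 : θ < Real.pi / 2) (hθη : θ * Real.tan θ ≤ η * (b - a)) :
    (θ / (b - a)) ^ 2 * ((∫ x in Set.Ioc a b, totalDensity ψ x) - 1)
      ≤ kineticOn ψ (Set.Ioc a b) + 2 * η * contactOn ψ (Set.Ioc a b) := by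
  have h := Finset.sum_le_sum fun j (_ : j ∈ Finset.univ) =>
    exclusion_at_coordinate hψ hcs j hη hab hθ hθ2 hθη
  rw [Finset.sum_add_distrib, ← Finset.mul_sum, ← Finset.mul_sum] at h
  refine le_trans (mul_le_mul_of_nonneg_left ?_ (sq_nonneg _)) h
  have hI := integrable_norm_sq hψ hcs
  have hQ : ∀ j, MeasurableSet {x : Fin N → ℝ | x j ∈ Set.Ioc a b} := fun j =>
    measurable_pi_apply j measurableSet_Ioc
  have hB : ∀ j, MeasurableSet
      {x : Fin N → ℝ | ∃ k : {k : Fin N // k ≠ j}, x k ∈ Set.Ioc a b} := fun j => by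
    rw [Set.ofPred_exists]
    exact MeasurableSet.iUnion fun k => hQ k
  rw [setIntegral_totalDensity hψ hcs measurableSet_Ioc, ← hnorm]
  simp only [← integral_indicator (hQ _)]
  rw [← integral_finsetSum _ fun j _ => hI.indicator (hQ j),
    ← integral_finsetSum _ fun j _ => (hI.indicator (hB j)).indicator (hQ j), ← integral_sub
      (integrable_finsetSum _ fun j _ => hI.indicator (hQ j)) hI]
  refine integral_mono ((integrable_finsetSum _ fun j _ => hI.indicator (hQ j)).sub hI)
    (integrable_finsetSum _ fun j _ => (hI.indicator (hB j)).indicator (hQ j)) fun x => ?_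
  have hx := mul_le_mul_of_nonneg_right (sum_indicator_sub_one_le (Set.Ioc a b) x)
    (sq_nonneg ‖ψ x‖)
  rw [sub_mul, Finset.sum_mul, Finset.sum_mul, one_mul] at hx
  classical
  simpa only [Set.indicator_apply, ite_mul, one_mul, zero_mul] using hx

theorem integral_insertCoord_eq_integral_insertPair (hψ : ContDiff ℝ (⊤ : ℕ∞) ψ)
    (hcs : HasCompactSupport ψ) {j p q : Fin N} (k : {k : Fin N // k ≠ j})
    (h : ∀ l, (l = p ∨ l = q) ↔ (l = j ∨ l = k)) :
    ∫ z : {k : Fin N // k ≠ j} → ℝ, ‖ψ (insertCoord j (z k) z)‖ ^ 2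
      = ∫ t : ℝ, ∫ w : {l : Fin N // l ≠ p ∧ l ≠ q} → ℝ, ‖ψ (insertPair p q t w)‖ ^ 2 := by
  have hnot : ∀ l, l ≠ p ∧ l ≠ q ↔ l ≠ j ∧ l ≠ k := fun l => by
    rw [← not_or, ← not_or, h]
  have hmp := measurePreserving_of_coordinates k
    (fun l : {l : Fin N // l ≠ p ∧ l ≠ q} =>
      (⟨l, ((hnot l).1 l.2).1⟩ : {k : Fin N // k ≠ j}))
    (fun l l' hl => Subtype.ext (by simpa using hl))
    (fun l hl => ((hnot l).1 l.2).2 (congrArg Subtype.val hl))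
    (fun i hi => ⟨⟨i, (hnot i).2 ⟨i.2, fun hik => hi (Subtype.ext hik)⟩⟩, rfl⟩)
    (fun x l => insertPair p q x.1 x.2 l)
    (fun x => dif_pos ((h k).2 (Or.inr rfl)))
    (fun x l => dif_neg (not_or.2 l.2))
  have hI := integrable_norm_sq_insertCoord hψ hcs j (continuous_apply k)
  rw [← MeasurePreserving.integral_comp_of_integrable hmp hI]
  refine (integral_prod _ (hmp.integrable_comp_of_integrable hI)).trans ?_
  refine integral_congr_ae (Filter.Eventually.of_forall fun t =>
    integral_congr_ae (Filter.Eventually.of_forall fun w => ?_))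
  simp only [Function.comp_apply]
  congr 3
  funext l
  by_cases hl : l = j
  · subst hl
    have hpair : ∀ i, i = p ∨ i = q → insertPair p q t w i = t := fun i hi => dif_pos hi
    rw [insertCoord_self, hpair k ((h k).2 (Or.inr rfl)), hpair l ((h l).2 (Or.inl rfl))]
  · exact insertCoord_coe j _ _ ⟨l, hl⟩

theorem two_mul_sum_contact_eq (hψ : ContDiff ℝ (⊤ : ℕ∞) ψ) (hcs : HasCompactSupport ψ) :
    2 * ∑ j : Fin N, ∑ k ∈ Finset.univ.filter (fun k => j < k),
        ∫ t : ℝ, ∫ z : {l : Fin N // l ≠ j ∧ l ≠ k} → ℝ, ‖ψ (insertPair j k t z)‖ ^ 2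
      = contactOn ψ Set.univ := by
  set I : Fin N → Fin N → ℝ := fun j k =>
    ∫ t : ℝ, ∫ z : {l : Fin N // l ≠ j ∧ l ≠ k} → ℝ, ‖ψ (insertPair j k t z)‖ ^ 2 with hI
  have hterm : ∀ (j : Fin N) (k : {k : Fin N // k ≠ j}),
      ∫ z in {z : {k : Fin N // k ≠ j} → ℝ | z k ∈ Set.univ}, ‖ψ (insertCoord j (z k) z)‖ ^ 2
        = (if j < k then I j k else 0) + if (k : Fin N) < j then I k j else 0 := by
    intro j k
    have huniv : {z : {k : Fin N // k ≠ j} → ℝ | z k ∈ Set.univ} = Set.univ := by ext; simp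
    rw [huniv, setIntegral_univ]
    rcases lt_or_gt_of_ne k.2 with hk | hk
    · rw [if_neg hk.not_gt, if_pos hk, zero_add]
      exact integral_insertCoord_eq_integral_insertPair hψ hcs k fun l => or_comm
    · rw [if_pos hk, if_neg hk.not_gt, add_zero]
      exact integral_insertCoord_eq_integral_insertPair hψ hcs k fun l => Iff.rfl
  have hsub : ∀ j : Fin N, (∑ k : {k : Fin N // k ≠ j},
      ((if j < k then I j k else 0) + if (k : Fin N) < j then I k j else 0))
        = ∑ k, ((if j < k then I j k else 0) + if k < j then I k j else 0) := by
    intro j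
    rw [← Finset.sum_subtype (Finset.univ.filter fun k => k ≠ j) (by simp)
      (fun k => (if j < k then I j k else 0) + if k < j then I k j else 0), Finset.sum_filter]
    refine Finset.sum_congr rfl fun k _ => ?_
    by_cases hk : k = j
    · simp [hk]
    · simp [hk]
  unfold contactOn
  simp only [hterm, hsub, Finset.sum_add_distrib, Finset.sum_filter]
  rw [Finset.sum_comm (f := fun j k : Fin N => if k < j then I k j else 0), two_mul]

theorem kineticOn_univ (hψ : ContDiff ℝ (⊤ : ℕ∞) ψ) (hcs : HasCompactSupport ψ) :
    kineticOn ψ Set.univ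
      = ∫ x : Fin N → ℝ, ∑ j : Fin N, ‖fderiv ℝ ψ x (Pi.single j 1)‖ ^ 2 := by
  rw [integral_finsetSum _ fun j _ => integrable_norm_sq_partialDeriv hψ hcs j]
  simp [kineticOn]

theorem exists_totalDensity_eq_zero (hcs : HasCompactSupport ψ) :
    ∃ R > 0, ∀ x, R < |x| → totalDensity ψ x = 0 := by
  obtain ⟨R, hR⟩ := hcs.isCompact.isBounded.subset_closedBall 0
  refine ⟨max R 1, by positivity, fun x hx => Finset.sum_eq_zero fun j _ => ?_⟩
  have hz : ∀ z, ψ (insertCoord j x z) = 0 := fun z => by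
    by_contra hne
    have h1 := hR (subset_tsupport ψ hne)
    rw [mem_closedBall_zero_iff] at h1
    have h2 := norm_le_pi_norm (insertCoord j x z) j
    rw [insertCoord_self, Real.norm_eq_abs] at h2
    linarith [le_max_left R 1]
  simp [densityAt_eq, hz]

end density

theorem le_maximalFn {ρ : ℝ → ℝ} {B : ℝ} (hρ : Integrable ρ) (hB : ∀ x, ρ x ≤ B) {a b x : ℝ}
    (hab : a < b) (hx : x ∈ Set.Icc a b) :
    (∫ y in Set.Ioc a b, ρ y) / (b - a) ≤ maximalFn ρ x := by
  rw [← integral_Icc_eq_integral_Ioc]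
  refine le_csSup ⟨B, ?_⟩ ⟨a, b, hab, hx, rfl⟩
  rintro t ⟨c, d, hcd, -, rfl⟩
  rw [div_le_iff₀ (sub_pos.2 hcd)]
  have h := setIntegral_mono (μ := volume) (s := Set.Icc c d) hρ.integrableOn
    (g := fun _ => B) (by simp) hB
  rw [setIntegral_const, Real.volume_real_Icc_of_le hcd.le, smul_eq_mul] at h
  linarith

theorem maximalFn_nonneg {ρ : ℝ → ℝ} (hρ : ∀ x, 0 ≤ ρ x) (x : ℝ) : 0 ≤ maximalFn ρ x := by
  refine Real.sSup_nonneg ?_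
  rintro t ⟨c, d, hcd, -, rfl⟩
  exact div_nonneg (integral_nonneg fun y => hρ y) (sub_pos.2 hcd).le

theorem monotoneOn_inverse_mul_tan {ξ : ℝ → ℝ}
    (hξ : ∀ y : ℝ, 0 ≤ y → 0 ≤ ξ y ∧ ξ y < Real.pi / 2 ∧ ξ y * Real.tan (ξ y) = y)
    {y z : ℝ} (hy : 0 ≤ y) (hyz : y ≤ z) : ξ y ≤ ξ z := by
  obtain ⟨hy0, hy1, hy2⟩ := hξ y hy
  obtain ⟨hz0, hz1, hz2⟩ := hξ z (hy.trans hyz)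
  by_contra! hlt
  have htan : Real.tan (ξ z) < Real.tan (ξ y) :=
    Real.strictMonoOn_tan ⟨by linarith [Real.pi_pos], hz1⟩ ⟨by linarith [Real.pi_pos], hy1⟩ hlt
  have hz3 : 0 ≤ Real.tan (ξ z) := Real.tan_nonneg_of_nonneg_of_le_pi_div_two hz0 hz1.le
  nlinarith

theorem inverse_mul_tan_sq_le {ξ : ℝ → ℝ}
    (hξ : ∀ y : ℝ, 0 ≤ y → 0 ≤ ξ y ∧ ξ y < Real.pi / 2 ∧ ξ y * Real.tan (ξ y) = y)
    {y : ℝ} (hy : 0 ≤ y) : ξ y ^ 2 ≤ 5 / 2 := by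
  obtain ⟨hy0, hy1, -⟩ := hξ y hy
  nlinarith [Real.pi_lt_d2]

/-- If intervals of mass `m` satisfy `c * ∫ g ≤ E`, so do intervals of mass a multiple of `m`. -/
theorem integral_le_of_forall_mass_eq {ρ g : ℝ → ℝ} (hρ : Integrable ρ) (hg : Integrable g)
    {E : Set ℝ → ℝ} {c m R : ℝ} (hm : 0 < m)
    (hadd : ∀ a b, a ≤ b → b ≤ R →
      E (Set.Ioc a R) = E (Set.Ioc a b) + E (Set.Ioc b R))
    (hE : ∀ a b, a < b → ∫ x in Set.Ioc a b, ρ x = m →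
      c * ∫ x in Set.Ioc a b, g x ≤ E (Set.Ioc a b))
    {n : ℕ} (hn : 1 ≤ n) {a : ℝ} (ha : ∫ x in Set.Ioc a R, ρ x = n * m) :
    c * ∫ x in Set.Ioc a R, g x ≤ E (Set.Ioc a R) := by
  have hlt : ∀ {s b t : ℝ}, 0 < t → ∫ x in Set.Ioc s b, ρ x = t → s < b := by
    intro s b t ht h
    by_contra! hle
    rw [Set.Ioc_eq_empty hle.not_gt, setIntegral_empty] at h
    exact ht.ne h
  induction n, hn using Nat.le_induction generalizing a with
  | base =>
    rw [Nat.cast_one, one_mul] at ha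
    exact hE a R (hlt hm ha) ha
  | succ n hn ih =>
    have haR : a < R := hlt (by positivity) ha
    have hcont : Continuous fun b => ∫ x in a..b, ρ x :=
      intervalIntegral.continuous_primitive (fun _ _ => hρ.intervalIntegrable) a
    obtain ⟨b, hb, hbm⟩ := intermediate_value_Icc haR.le hcont.continuousOn
      (show m ∈ Set.Icc _ _ by
        rw [intervalIntegral.integral_same, intervalIntegral.integral_of_le haR.le, ha]
        refine ⟨hm.le, ?_⟩
        push_cast
        nlinarith [mul_nonneg (Nat.cast_nonneg (α := ℝ) n) hm.le])
    simp only [intervalIntegral.integral_of_le hb.1] at hbm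
    have hsplit : ∀ f : ℝ → ℝ, Integrable f → ∫ x in Set.Ioc a R, f x
        = (∫ x in Set.Ioc a b, f x) + ∫ x in Set.Ioc b R, f x := fun f hf => by
      rw [← Set.Ioc_union_Ioc_eq_Ioc hb.1 hb.2]
      exact setIntegral_union (Set.Ioc_disjoint_Ioc_of_le le_rfl) measurableSet_Ioc
        hf.integrableOn hf.integrableOn
    have hbR : ∫ x in Set.Ioc b R, ρ x = n * m := by
      have := hsplit ρ hρ
      rw [ha, hbm] at this
      push_cast at this
      linarith
    rw [hsplit g hg, hadd a b hb.1 hb.2, mul_add]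
    exact add_le_add (hE a b (hlt hm hbm) hbm) (ih hbR)

section localBound

variable {N : ℕ} {ψ : (Fin N → ℝ) → ℂ}

theorem local_bound (hψ : ContDiff ℝ (⊤ : ℕ∞) ψ) (hcs : HasCompactSupport ψ)
    (hnorm : ∫ x : Fin N → ℝ, ‖ψ x‖ ^ 2 = 1) {η : ℝ} (hη : 0 ≤ η) {ξ : ℝ → ℝ}
    (hξ : ∀ y : ℝ, 0 ≤ y → 0 ≤ ξ y ∧ ξ y < Real.pi / 2 ∧ ξ y * Real.tan (ξ y) = y)
    (hg : Integrable fun x => ξ (2 * η / maximalFn (totalDensity ψ) x) ^ 2 * totalDensity ψ x ^ 3)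
    {B : ℝ} (hB : ∀ x, totalDensity ψ x ≤ B) {a b : ℝ} (hab : a < b)
    (hm2 : 2 ≤ ∫ x in Set.Ioc a b, totalDensity ψ x)
    (hm3 : ∫ x in Set.Ioc a b, totalDensity ψ x ≤ 3) :
    3e-5 * ∫ x in Set.Ioc a b,
        ξ (2 * η / maximalFn (totalDensity ψ) x) ^ 2 * totalDensity ψ x ^ 3
      ≤ 1 / 2 * kineticOn ψ (Set.Ioc a b) + η * contactOn ψ (Set.Ioc a b) := by
  have hρ := integrable_totalDensity hψ hcs
  have hL : 0 < b - a := sub_pos.2 hab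
  have hηL : 0 ≤ η * (b - a) := by positivity
  obtain ⟨hθ0, hθ1, hθ2⟩ := hξ _ hηL
  have hθsq := inverse_mul_tan_sq_le hξ hηL
  have hexcl := exclusion_on_interval hψ hcs hnorm hη hab hθ0 hθ1 hθ2.le
  have hsup := fun x hx => totalDensity_le_of_interval hψ hcs (x := x) hab hx
  have hmax := fun x hx => le_maximalFn hρ hB (x := x) hab hx
  have hK := kineticOn_nonneg ψ (Set.Ioc a b)
  have hC := mul_nonneg hη (contactOn_nonneg ψ (Set.Ioc a b))
  set m := ∫ x in Set.Ioc a b, totalDensity ψ x with hm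
  set θ := ξ (η * (b - a))
  set K := kineticOn ψ (Set.Ioc a b)
  set C := contactOn ψ (Set.Ioc a b)
  set S := m / (b - a) + (m + 1) * √K with hS
  have hint : ∫ x in Set.Ioc a b,
      ξ (2 * η / maximalFn (totalDensity ψ) x) ^ 2 * totalDensity ψ x ^ 3 ≤ θ ^ 2 * S ^ 2 * m := by
    rw [hm, ← integral_const_mul]
    refine setIntegral_mono_on hg.integrableOn (hρ.const_mul _).integrableOn measurableSet_Ioc
      fun x hx => ?_
    have hx' := Set.Ioc_subset_Icc_self hx
    have hM := hmax x hx'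
    have hMpos : 0 < maximalFn (totalDensity ψ) x :=
      lt_of_lt_of_le (div_pos (by linarith) hL) hM
    have harg : 2 * η / maximalFn (totalDensity ψ) x ≤ η * (b - a) := by
      rw [div_le_iff₀ hMpos]
      rw [div_le_iff₀ hL] at hM
      nlinarith
    have harg0 : 0 ≤ 2 * η / maximalFn (totalDensity ψ) x := by positivity
    have h1 := monotoneOn_inverse_mul_tan hξ harg0 harg
    have h0 := (hξ _ harg0).1
    have hρ0 := totalDensity_nonneg ψ x
    calc _ ≤ θ ^ 2 * (totalDensity ψ x ^ 2 * totalDensity ψ x) := by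
          rw [← pow_succ]
          gcongr
      _ ≤ θ ^ 2 * (S ^ 2 * totalDensity ψ x) := by
          gcongr
          exact hsup x hx'
      _ = _ := by ring
  have hSsq : S ^ 2 ≤ 18 / (b - a) ^ 2 + 32 * K := by
    have h1 : S ^ 2 ≤ 2 * (m / (b - a)) ^ 2 + 2 * ((m + 1) * √K) ^ 2 := by
      rw [hS]; nlinarith [sq_nonneg (m / (b - a) - (m + 1) * √K)]
    have h2 : (m / (b - a)) ^ 2 ≤ 9 / (b - a) ^ 2 := by
      rw [div_pow]
      gcongr
      nlinarith
    have h3 : ((m + 1) * √K) ^ 2 ≤ 16 * K := by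
      rw [mul_pow, Real.sq_sqrt hK]
      gcongr
      nlinarith
    have h4 : 18 / (b - a) ^ 2 = 2 * (9 / (b - a) ^ 2) := by ring
    linarith
  have hθL : (θ / (b - a)) ^ 2 ≤ K + 2 * η * C := by
    refine le_trans ?_ hexcl
    nlinarith [sq_nonneg (θ / (b - a))]
  have hfin : θ ^ 2 * S ^ 2 * m ≤ 54 * (θ / (b - a)) ^ 2 + 240 * K := by
    have h1 : θ ^ 2 * S ^ 2 ≤ 18 * (θ / (b - a)) ^ 2 + 80 * K := by
      calc θ ^ 2 * S ^ 2 ≤ θ ^ 2 * (18 / (b - a) ^ 2 + 32 * K) := by gcongr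
        _ = 18 * (θ / (b - a)) ^ 2 + θ ^ 2 * (32 * K) := by rw [div_pow]; ring
        _ ≤ 18 * (θ / (b - a)) ^ 2 + 5 / 2 * (32 * K) := by gcongr
        _ = _ := by ring
    have h2 : θ ^ 2 * S ^ 2 * m ≤ θ ^ 2 * S ^ 2 * 3 := by gcongr
    linarith
  linarith

end localBound

/-- **Kinetic energy inequality for the 1D Lieb–Liniger model.** For `η ≥ 0`, a normalized
symmetric `ψ ∈ C_c^∞(ℝᴺ)` with one-particle density `ρ(x) = N∫|ψ(x,x₂,…,x_N)|²` and
`ξ_S : [0,∞) → [0,π/2)` the inverse of `t ↦ t·tan t`, the Lieb–Liniger energy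
`T_S(ψ)` (free kinetic energy plus delta interactions of strength `2η`) satisfies
`T_S(ψ) ≥ 3·10⁻⁵ ∫ ξ_S(2η/ρ*(x))² ρ(x)³ dx` with `ρ*` the maximal function of `ρ`. -/
theorem kinetic_energy_inequality_lieb_liniger
    (η : ℝ) (hη : 0 ≤ η) (N : ℕ) (hN : 1 ≤ N)
    (ξS : ℝ → ℝ)
    (hξS : ∀ y : ℝ, 0 ≤ y →
      0 ≤ ξS y ∧ ξS y < Real.pi / 2 ∧ ξS y * Real.tan (ξS y) = y)
    (ψ : (Fin N → ℝ) → ℂ)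
    (hψ : ContDiff ℝ (⊤ : ℕ∞) ψ) (hcs : HasCompactSupport ψ)
    (hsym : ∀ (σ : Equiv.Perm (Fin N)) (x : Fin N → ℝ), ψ (x ∘ σ) = ψ x)
    (hnorm : ∫ x : Fin N → ℝ, ‖ψ x‖ ^ 2 = 1) :
    (1 / 2) * (∫ x : Fin N → ℝ, ∑ j : Fin N, ‖fderiv ℝ ψ x (Pi.single j 1)‖ ^ 2)
      + 2 * η * ∑ j : Fin N, ∑ k ∈ Finset.univ.filter (fun k => j < k),
          ∫ t : ℝ, ∫ z : {l : Fin N // l ≠ j ∧ l ≠ k} → ℝ,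
            ‖ψ (insertPair j k t z)‖ ^ 2
      ≥ 3e-5 * ∫ x : ℝ,
          ξS (2 * η / maximalFn (fun y => (N : ℝ) * densityAt ψ (⟨0, by omega⟩ : Fin N) y) x) ^ 2
            * ((N : ℝ) * densityAt ψ (⟨0, by omega⟩ : Fin N) x) ^ 3 := by
  have hdens : ∀ y, (N : ℝ) * densityAt ψ (⟨0, by omega⟩ : Fin N) y = totalDensity ψ y := by
    intro y
    simp [totalDensity, densityAt_eq_of_symmetric hsym _ (⟨0, by omega⟩ : Fin N)]
  simp only [hdens]
  have hρ := integrable_totalDensity hψ hcs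
  have hρ0 := totalDensity_nonneg ψ
  have hρN := integral_totalDensity hψ hcs hnorm
  have hK := kineticOn_nonneg ψ Set.univ
  have hC := mul_nonneg hη (contactOn_nonneg ψ Set.univ)
  rw [ge_iff_le, ← kineticOn_univ hψ hcs, mul_comm 2 η, mul_assoc η, two_mul_sum_contact_eq hψ hcs,
    mul_comm η 2]
  by_cases hg : Integrable fun x =>
    ξS (2 * η / maximalFn (totalDensity ψ) x) ^ 2 * totalDensity ψ x ^ 3
  swap
  · rw [integral_undef hg]
    linarith
  obtain ⟨R, hR, hzero⟩ := exists_totalDensity_eq_zero hcs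
  have hB := totalDensity_le_of_eq_zero hψ hcs hnorm
    (hzero (R + 1) (by rw [abs_of_pos (by linarith)]; linarith))
  rcases hN.eq_or_lt with hN1 | hN2
  · have hN1' : (N : ℝ) = 1 := by exact_mod_cast hN1.symm
    have hle : ∫ x, ξS (2 * η / maximalFn (totalDensity ψ) x) ^ 2 * totalDensity ψ x ^ 3
        ≤ ∫ x, 10 * kineticOn ψ Set.univ * totalDensity ψ x := by
      refine integral_mono hg (hρ.const_mul _) fun x => ?_
      have h1 := inverse_mul_tan_sq_le hξS
        (div_nonneg (mul_nonneg zero_le_two hη) (maximalFn_nonneg hρ0 x))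
      have h2 : totalDensity ψ x ^ 2 ≤ 4 * kineticOn ψ Set.univ := by
        have h3 := pow_le_pow_left₀ (hρ0 x) (hB x) 2
        rw [mul_pow, Real.sq_sqrt hK, hN1'] at h3
        norm_num at h3
        exact h3
      have hx := hρ0 x
      calc _ = ξS (2 * η / maximalFn (totalDensity ψ) x) ^ 2 *
            (totalDensity ψ x ^ 2 * totalDensity ψ x) := by ring
        _ ≤ 5 / 2 * (4 * kineticOn ψ Set.univ * totalDensity ψ x) := by gcongr
        _ = _ := by ring
    rw [integral_const_mul, hρN, hN1', mul_one] at hle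
    linarith
  · have hq : 1 ≤ N / 2 := by omega
    have hq' : (1 : ℝ) ≤ (N / 2 : ℕ) := by exact_mod_cast hq
    have hq0 : (0 : ℝ) < (N / 2 : ℕ) := by linarith
    have hm2 : (2 : ℝ) ≤ N / (N / 2 : ℕ) := by
      rw [le_div_iff₀ hq0]
      exact_mod_cast (by omega : 2 * (N / 2) ≤ N)
    have hm3 : (N : ℝ) / (N / 2 : ℕ) ≤ 3 := by
      rw [div_le_iff₀ hq0]
      exact_mod_cast (by omega : N ≤ 3 * (N / 2))
    have hrestrict : ∀ f : ℝ → ℝ, (∀ x, totalDensity ψ x = 0 → f x = 0) →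
        ∫ x in Set.Ioc (-(R + 1)) (R + 1), f x = ∫ x, f x := fun f hf => by
      refine setIntegral_eq_integral_of_forall_compl_eq_zero fun x hx => hf x (hzero x ?_)
      by_contra! hle
      obtain ⟨h1, h2⟩ := abs_le.1 hle
      exact hx ⟨by linarith, by linarith⟩
    have hmass : ∫ x in Set.Ioc (-(R + 1)) (R + 1), totalDensity ψ x
        = (N / 2 : ℕ) * ((N : ℝ) / (N / 2 : ℕ)) := by
      rw [hrestrict _ fun x hx => hx, hρN, mul_div_cancel₀ _ hq0.ne']
    have hmain := integral_le_of_forall_mass_eq hρ hg (c := 3e-5) (R := R + 1)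
      (E := fun Q => 1 / 2 * kineticOn ψ Q + η * contactOn ψ Q) (by linarith)
      (fun a b hab hb => by
        have hdisj : Disjoint (Set.Ioc a b) (Set.Ioc b (R + 1)) :=
          Set.Ioc_disjoint_Ioc_of_le le_rfl
        rw [← Set.Ioc_union_Ioc_eq_Ioc hab hb, kineticOn_union hψ hcs measurableSet_Ioc hdisj,
          contactOn_union hψ hcs measurableSet_Ioc hdisj]
        ring)
      (fun a b hab h => local_bound hψ hcs hnorm hη hξS hg hB hab (h ▸ hm2) (h ▸ hm3)) hq hmass
    rw [hrestrict _ fun x hx => by simp [hx]] at hmain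
    have hk := kineticOn_le_univ hψ hcs (measurableSet_Ioc (a := -(R + 1)) (b := R + 1))
    have hc := mul_le_mul_of_nonneg_left
      (contactOn_le_univ hψ hcs (measurableSet_Ioc (a := -(R + 1)) (b := R + 1))) hη
    linarith
end

section
/- For every constant C > 0 there exist α ≥ 1, an integer N ≥ 2, and a smooth, symmetric, normalized function ψ : ℝ^N → ℂ vanishing on a neighborhood of the diagonal set {x : x_j = x_k for some j ≠ k}, such that the total Calogero–Sutherland kinetic energy satisfies ∫_{ℝ^N} [ (1/2)·∑_{j=1}^N |∂_j ψ|² + ∑_{1≤j<k≤N} α(α−1)·|ψ|²/(x_j − x_k)² ] dx < C·α(α−1)·∫_ℝ ρ(x)³ dx, where ρ(x) := N·∫|ψ(x, x_2,…,x_N)|² dx_2⋯dx_N is the one-particle density. Consequently, a Lieb–Thirring inequality of the form T_H ≥ C·α(α−1)·∫ρ³ (and a fortiori with α(α−1) replaced by the larger quantity ξ_H(α)²) cannot hold for all α ≥ 1 and all states with any positive constant C independent of α. -/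
open MeasureTheory

/-- The AM-GM inequality `3 t² r ≤ r³ + 2 t³`. -/
lemma three_mul_sq_mul_le {r t : ℝ} (hr : 0 ≤ r) (ht : 0 ≤ t) :
    3 * t ^ 2 * r - 2 * t ^ 3 ≤ r ^ 3 := by
  nlinarith [mul_nonneg (add_nonneg hr (add_nonneg ht ht)) (sq_nonneg (r - t))]

/-- Smooth real functions with unit `L²` norm and arbitrarily small support exist. -/
lemma exists_contDiff_integral_sq_eq_one {ε : ℝ} (hε : 0 < ε) :
    ∃ f : ℝ → ℝ, ContDiff ℝ (⊤ : ℕ∞) f ∧ (∀ x, ε ≤ |x| → f x = 0) ∧ ∫ x, f x ^ 2 = 1 := by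
  let b : ContDiffBump (0 : ℝ) := ⟨ε / 2, ε, by positivity, by linarith⟩
  have hpos : 0 < ∫ x, b x ^ 2 := by
    refine (b.continuous.pow 2).integral_pos_of_hasCompactSupport_nonneg_nonzero ?_
      (fun x => sq_nonneg _) (x := 0) ?_
    · exact b.hasCompactSupport.comp_left (g := fun y : ℝ => y ^ 2) (by simp)
    · have : b 0 = 1 := b.one_of_mem_closedBall (by simp [b]; positivity)
      simp [this]
  refine ⟨fun x => b x / √(∫ x, b x ^ 2), b.contDiff.div_const _, fun x hx => ?_, ?_⟩
  · have : b x = 0 := b.zero_of_le_dist (by simpa [b, Real.dist_eq] using hx)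
    simp [this]
  · simp_rw [div_pow, Real.sq_sqrt hpos.le]
    rw [integral_div, div_self hpos.ne']

/-- An `L²`-normalized function supported in `[-ε, ε]` has `∫ f⁶ ≥ 1 / (4 ε²)`. -/
lemma inv_four_mul_sq_le_integral_pow_six {f : ℝ → ℝ} {ε : ℝ} (hε : 0 < ε)
    (hf : ∀ x, ε ≤ |x| → f x = 0) (hf1 : ∫ x, f x ^ 2 = 1)
    (hfi : Integrable fun x => (f x ^ 2) ^ 3) :
    1 / (4 * ε ^ 2) ≤ ∫ x, (f x ^ 2) ^ 3 := by
  have hfi2 : Integrable (fun x => f x ^ 2) := integrable_of_integral_eq_one hf1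
  set t : ℝ := 1 / (2 * ε) with ht
  have ht0 : 0 ≤ t := by positivity
  have hS : Integrable ((Set.Icc (-ε) ε).indicator fun _ : ℝ => 2 * t ^ 3) := by
    rw [integrable_indicator_iff measurableSet_Icc]
    exact continuousOn_const.integrableOn_Icc
  calc 1 / (4 * ε ^ 2)
      = ∫ x, (3 * t ^ 2 * f x ^ 2 - (Set.Icc (-ε) ε).indicator (fun _ : ℝ => 2 * t ^ 3) x) := by
        rw [integral_sub (hfi2.const_mul _) hS, integral_const_mul, hf1,
          integral_indicator measurableSet_Icc, setIntegral_const, Measure.real, Real.volume_Icc,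
          ENNReal.toReal_ofReal (by linarith), smul_eq_mul, ht]
        field_simp
        ring
    _ ≤ ∫ x, (f x ^ 2) ^ 3 := by
        refine integral_mono ((hfi2.const_mul _).sub hS) hfi fun x => ?_
        by_cases hx : x ∈ Set.Icc (-ε) ε
        · simpa [Set.indicator_of_mem hx] using three_mul_sq_mul_le (sq_nonneg (f x)) ht0
        · have : f x = 0 := hf x (by
            by_contra! h
            exact hx ⟨(abs_lt.1 h).1.le, (abs_lt.1 h).2.le⟩)
          simp [Set.indicator_of_notMem hx, this]

/-- The symmetrized product of `f` with its translate by one. -/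
noncomputable def twoBump (f : ℝ → ℝ) (x : Fin 2 → ℝ) : ℂ :=
  (((f (x 0) * f (x 1 - 1) + f (x 1) * f (x 0 - 1)) / √2 : ℝ) : ℂ)

section TwoBump

variable {f : ℝ → ℝ} {ε : ℝ}

lemma contDiff_twoBump (hf : ContDiff ℝ (⊤ : ℕ∞) f) : ContDiff ℝ (⊤ : ℕ∞) (twoBump f) := by
  unfold twoBump
  refine Complex.ofRealCLM.contDiff.comp (ContDiff.div_const ?_ _)
  fun_prop

lemma twoBump_comp_perm (σ : Equiv.Perm (Fin 2)) (x : Fin 2 → ℝ) :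
    twoBump f (x ∘ σ) = twoBump f x := by
  have h : σ 0 = 0 ∧ σ 1 = 1 ∨ σ 0 = 1 ∧ σ 1 = 0 := by
    revert σ
    decide
  rcases h with ⟨h0, h1⟩ | ⟨h0, h1⟩
  · simp [twoBump, h0, h1]
  · simp only [twoBump, Function.comp_apply, h0, h1]
    rw [add_comm]

lemma abs_lt_of_apply_ne_zero (hf : ∀ x, ε ≤ |x| → f x = 0) {x : ℝ} (hx : f x ≠ 0) :
    |x| < ε := by
  contrapose! hx
  exact hf x hx

/-- On the support of `twoBump f` one coordinate is close to `0` and the other to `1`. -/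
lemma near_of_twoBump_ne_zero (hf : ∀ x, ε ≤ |x| → f x = 0) {x : Fin 2 → ℝ}
    (hx : twoBump f x ≠ 0) :
    |x 0| < ε ∧ |x 1 - 1| < ε ∨ |x 1| < ε ∧ |x 0 - 1| < ε := by
  by_contra h
  apply hx
  have h1 : f (x 0) * f (x 1 - 1) = 0 := by
    by_contra h'
    exact h (Or.inl ⟨abs_lt_of_apply_ne_zero hf (left_ne_zero_of_mul h'),
      abs_lt_of_apply_ne_zero hf (right_ne_zero_of_mul h')⟩)
  have h2 : f (x 1) * f (x 0 - 1) = 0 := by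
    by_contra h'
    exact h (Or.inr ⟨abs_lt_of_apply_ne_zero hf (left_ne_zero_of_mul h'),
      abs_lt_of_apply_ne_zero hf (right_ne_zero_of_mul h')⟩)
  simp [twoBump, h1, h2]

lemma half_lt_abs_sub_of_twoBump_ne_zero (hε : ε ≤ 1 / 4) (hf : ∀ x, ε ≤ |x| → f x = 0)
    {x : Fin 2 → ℝ} (hx : twoBump f x ≠ 0) : 1 / 2 < |x 0 - x 1| := by
  rcases near_of_twoBump_ne_zero hf hx with ⟨h0, h1⟩ | ⟨h0, h1⟩ <;>
    rw [abs_lt] at h0 h1 <;> rw [lt_abs]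
  · right; linarith
  · left; linarith

lemma hasCompactSupport_twoBump (hε : ε ≤ 1 / 4) (hf : ∀ x, ε ≤ |x| → f x = 0) :
    HasCompactSupport (twoBump f) := by
  refine HasCompactSupport.intro (isCompact_Icc (a := fun _ : Fin 2 => (-2 : ℝ)) (b := fun _ => 2))
    fun x hx => ?_
  by_contra h
  apply hx
  rcases near_of_twoBump_ne_zero hf h with ⟨h0, h1⟩ | ⟨h0, h1⟩ <;>
    rw [abs_lt] at h0 h1 <;>
    refine ⟨fun i => ?_, fun i => ?_⟩ <;> fin_cases i <;> simp <;> linarith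

lemma norm_twoBump_sq (hε : ε ≤ 1 / 4) (hf : ∀ x, ε ≤ |x| → f x = 0) (x : Fin 2 → ℝ) :
    ‖twoBump f x‖ ^ 2 =
      (f (x 0) ^ 2 * f (x 1 - 1) ^ 2 + f (x 1) ^ 2 * f (x 0 - 1) ^ 2) / 2 := by
  have h : f (x 0) * f (x 0 - 1) = 0 := by
    by_contra h
    have h0 := abs_lt.1 (abs_lt_of_apply_ne_zero hf (left_ne_zero_of_mul h))
    have h1 := abs_lt.1 (abs_lt_of_apply_ne_zero hf (right_ne_zero_of_mul h))
    linarith [h0.2, h1.1]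
  rw [twoBump, Complex.norm_real, Real.norm_eq_abs, sq_abs, div_pow, Real.sq_sqrt (by norm_num)]
  linear_combination (f (x 1) * f (x 1 - 1)) * h

lemma integral_norm_twoBump_sq (hε : ε ≤ 1 / 4) (hf : ∀ x, ε ≤ |x| → f x = 0)
    (hf1 : ∫ x, f x ^ 2 = 1) : ∫ x, ‖twoBump f x‖ ^ 2 = 1 := by
  have hf1' : ∫ x, f (x - 1) ^ 2 = 1 := by
    rw [integral_sub_right_eq_self (fun x => f x ^ 2) 1, hf1]
  have hfi : Integrable fun x => f x ^ 2 := integrable_of_integral_eq_one hf1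
  have hfi' : Integrable fun x => f (x - 1) ^ 2 := hfi.comp_sub_right 1
  have key : ∀ g h : ℝ → ℝ, Integrable g → Integrable h →
      Integrable (fun x : Fin 2 → ℝ => g (x 0) * h (x 1)) ∧
      ∫ x : Fin 2 → ℝ, g (x 0) * h (x 1) = (∫ y, g y) * ∫ y, h y := by
    intro g h hg hh
    have e := integral_fintype_prod_volume_eq_prod (fun i : Fin 2 => ![g, h] i)
    have i := Integrable.fintype_prod (μ := fun _ : Fin 2 => (volume : Measure ℝ))
      (f := fun i : Fin 2 => ![g, h] i) (by intro i; fin_cases i <;> simpa)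
    simp only [Fin.prod_univ_two] at e i
    exact ⟨i, e⟩
  obtain ⟨i1, e1⟩ := key _ _ hfi hfi'
  obtain ⟨i2, e2⟩ := key _ _ hfi' hfi
  have e : ∀ x : Fin 2 → ℝ, ‖twoBump f x‖ ^ 2 =
      (f (x 0) ^ 2 * f (x 1 - 1) ^ 2 + f (x 0 - 1) ^ 2 * f (x 1) ^ 2) / 2 := fun x => by
    rw [norm_twoBump_sq hε hf, mul_comm (f (x 1) ^ 2)]
  simp_rw [e]
  rw [integral_div, integral_add i1 i2, e1, e2, hf1, hf1']
  norm_num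

lemma densityAt_twoBump (hε : ε ≤ 1 / 4) (hf : ∀ x, ε ≤ |x| → f x = 0)
    (hf1 : ∫ x, f x ^ 2 = 1) (y : ℝ) :
    densityAt (twoBump f) 0 y = (f y ^ 2 + f (y - 1) ^ 2) / 2 := by
  have hf1' : ∫ x, f (x - 1) ^ 2 = 1 := by
    rw [integral_sub_right_eq_self (fun x => f x ^ 2) 1, hf1]
  have hfi : Integrable fun x => f x ^ 2 := integrable_of_integral_eq_one hf1
  have hfi' : Integrable fun x => f (x - 1) ^ 2 := hfi.comp_sub_right 1
  let _ : Unique {k : Fin 2 // k ≠ 0} :=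
    ⟨⟨⟨1, by decide⟩⟩, fun k => Subtype.ext (by grind)⟩
  have e := (volume_preserving_funUnique {k : Fin 2 // k ≠ 0} ℝ).integral_comp'
    (g := fun z : ℝ => (f y ^ 2 * f (z - 1) ^ 2 + f z ^ 2 * f (y - 1) ^ 2) / 2)
  have e' : ∫ z, (f y ^ 2 * f (z - 1) ^ 2 + f z ^ 2 * f (y - 1) ^ 2) / 2 =
      (f y ^ 2 + f (y - 1) ^ 2) / 2 := by
    rw [integral_div, integral_add (hfi'.const_mul _) (hfi.mul_const _), integral_const_mul,
      integral_mul_const, hf1, hf1', mul_one, one_mul]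
  rw [← e', ← e, densityAt]
  refine integral_congr_ae (Filter.Eventually.of_forall fun z => ?_)
  simp only [norm_twoBump_sq hε hf]
  rfl

end TwoBump

/-- **Necessity of the averaged density in the Calogero–Sutherland Lieb–Thirring
inequality.** For every `C > 0` there are `α ≥ 1`, `N ≥ 2` and a normalized symmetric
smooth wave function `ψ` vanishing near the diagonals whose total Calogero–Sutherland
kinetic energy is strictly smaller than `C·α(α-1)·∫ρ³`; hence no bound
`T_H ≥ C·α(α-1)·∫ρ³` (a fortiori none with `ξ_H(α)²` in place of `α(α-1)`) can hold
with a constant independent of `α`. -/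
theorem no_uniform_lieb_thirring_calogero_sutherland :
    ∀ C : ℝ, 0 < C →
    ∃ α : ℝ, 1 ≤ α ∧ ∃ N : ℕ, ∃ hN : 2 ≤ N, ∃ ψ : (Fin N → ℝ) → ℂ,
      ContDiff ℝ (⊤ : ℕ∞) ψ ∧ HasCompactSupport ψ ∧
      (∀ (σ : Equiv.Perm (Fin N)) (x : Fin N → ℝ), ψ (x ∘ σ) = ψ x) ∧
      (∫ x : Fin N → ℝ, ‖ψ x‖ ^ 2 = 1) ∧
      (∃ U : Set (Fin N → ℝ), IsOpen U ∧
        {x : Fin N → ℝ | ∃ j k : Fin N, j ≠ k ∧ x j = x k} ⊆ U ∧ ∀ x ∈ U, ψ x = 0) ∧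
      (∫ x : Fin N → ℝ,
          ((1 / 2) * ∑ j : Fin N, ‖fderiv ℝ ψ x (Pi.single j 1)‖ ^ 2
            + ∑ j : Fin N, ∑ k ∈ Finset.univ.filter (fun k => j < k),
                α * (α - 1) * ‖ψ x‖ ^ 2 / (x j - x k) ^ 2))
        < C * (α * (α - 1)) *
            ∫ y : ℝ, ((N : ℝ) * densityAt ψ (⟨0, by omega⟩ : Fin N) y) ^ 3 := by
  intro C hC
  obtain ⟨ε, hε0, hε, hεC⟩ : ∃ ε : ℝ, 0 < ε ∧ ε ≤ 1 / 4 ∧ 5 ≤ C * (1 / (4 * ε ^ 2)) := by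
    refine ⟨min (1 / 4) (C / 5), by positivity, min_le_left _ _, ?_⟩
    set ε := min (1 / 4) (C / 5)
    have h0 : 0 < ε := by positivity
    have h1 : ε ≤ 1 / 4 := min_le_left _ _
    have h2 : ε ≤ C / 5 := min_le_right _ _
    rw [mul_one_div, le_div_iff₀ (by positivity)]
    nlinarith
  obtain ⟨f, hfs, hf, hf1⟩ := exists_contDiff_integral_sq_eq_one hε0
  have hcs := hasCompactSupport_twoBump hε hf
  have hsm := contDiff_twoBump hfs
  have hnorm := integral_norm_twoBump_sq hε hf hf1
  set ψ := twoBump f with hψ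
  set A : (Fin 2 → ℝ) → ℝ :=
    fun x => (1 / 2) * ∑ j : Fin 2, ‖fderiv ℝ ψ x (Pi.single j 1)‖ ^ 2
  have hAnn : ∀ x, 0 ≤ A x := fun x => by positivity
  have hAint : Integrable A := by
    have hc : Continuous (fderiv ℝ ψ) := hsm.continuous_fderiv (by simp)
    refine Continuous.integrable_of_hasCompactSupport (by fun_prop) ?_
    exact (hcs.fderiv ℝ).comp_left (g := fun L : (Fin 2 → ℝ) →L[ℝ] ℂ =>
      (1 / 2 : ℝ) * ∑ j : Fin 2, ‖L (Pi.single j 1)‖ ^ 2) (by simp)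
  have hψint : Integrable fun x => ‖ψ x‖ ^ 2 := integrable_of_integral_eq_one hnorm
  set K := ∫ x, A x with hK
  have hK0 : 0 ≤ K := integral_nonneg hAnn
  have hα : 0 ≤ (K + 2) * (K + 2 - 1) := by nlinarith
  have hρ : 1 / (4 * ε ^ 2) ≤ ∫ y : ℝ, (((2 : ℕ) : ℝ) * densityAt ψ 0 y) ^ 3 := by
    have hfcs : HasCompactSupport f :=
      HasCompactSupport.intro (isCompact_Icc (a := -ε) (b := ε)) fun x hx => hf x (by
        by_contra! h
        exact hx ⟨(abs_lt.1 h).1.le, (abs_lt.1 h).2.le⟩)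
    have hfc := hfs.continuous
    have hgcs : HasCompactSupport fun x => f (x - 1) :=
      hfcs.comp_homeomorph (Homeomorph.subRight (1 : ℝ))
    have hfi : Integrable fun x => (f x ^ 2) ^ 3 :=
      Continuous.integrable_of_hasCompactSupport (by fun_prop)
        (hfcs.comp_left (g := fun y : ℝ => (y ^ 2) ^ 3) (by simp))
    refine (inv_four_mul_sq_le_integral_pow_six hε0 hf hf1 hfi).trans ?_
    refine integral_mono hfi ?_ fun y => ?_
    · simp_rw [hψ, densityAt_twoBump hε hf hf1]
      refine Continuous.integrable_of_hasCompactSupport (by fun_prop) ?_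
      exact hfcs.comp₂_left hgcs
        (m := fun a b : ℝ => (((2 : ℕ) : ℝ) * ((a ^ 2 + b ^ 2) / 2)) ^ 3) (by simp)
    · simp only [hψ, densityAt_twoBump hε hf hf1]
      gcongr
      push_cast
      nlinarith [sq_nonneg (f (y - 1))]
  refine ⟨K + 2, by linarith, 2, le_rfl, ψ, hsm, hcs, twoBump_comp_perm, hnorm,
    ⟨{x | |x 0 - x 1| < 1 / 2}, ?_, ?_, ?_⟩, ?_⟩
  · exact isOpen_lt (by fun_prop) continuous_const
  · rintro x ⟨j, k, hjk, hx⟩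
    have : x 0 = x 1 := by
      fin_cases j <;> fin_cases k <;> simp_all
    simp [this]
  · intro x hx
    by_contra h
    exact lt_asymm hx (half_lt_abs_sub_of_twoBump_ne_zero hε hf h)
  · calc _ ≤ ∫ x, (A x + 4 * ((K + 2) * (K + 2 - 1)) * ‖ψ x‖ ^ 2) := by
          refine integral_mono_of_nonneg (Filter.Eventually.of_forall fun x => ?_)
            (hAint.add (hψint.const_mul _)) (Filter.Eventually.of_forall fun x => ?_)
          · refine add_nonneg (hAnn x) ?_
            exact Finset.sum_nonneg fun j _ => Finset.sum_nonneg fun k _ => by positivity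
          · refine add_le_add le_rfl ?_
            have h0 : Finset.univ.filter (fun k : Fin 2 => 0 < k) = {1} := by decide
            have h1 : Finset.univ.filter (fun k : Fin 2 => 1 < k) = ∅ := by decide
            rw [Fin.sum_univ_two, h0, h1, Finset.sum_singleton, Finset.sum_empty, add_zero]
            by_cases hx : ψ x = 0
            · simp [hx]
            have hd := half_lt_abs_sub_of_twoBump_ne_zero hε hf hx
            have hd2 : 1 / 4 ≤ (x 0 - x 1) ^ 2 := by
              rw [← sq_abs]
              nlinarith
            rw [div_le_iff₀ (by linarith)]
            have hp : 0 ≤ (K + 2) * (K + 2 - 1) * ‖ψ x‖ ^ 2 := by positivity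
            nlinarith
      _ = K + 4 * ((K + 2) * (K + 2 - 1)) := by
          rw [integral_add hAint (hψint.const_mul _), ← hK, integral_const_mul, hnorm, mul_one]
      _ < (K + 2) * (K + 2 - 1) * 5 := by nlinarith
      _ ≤ (K + 2) * (K + 2 - 1) * (C * (1 / (4 * ε ^ 2))) := by gcongr
      _ ≤ (K + 2) * (K + 2 - 1) * (C * ∫ y : ℝ, (((2 : ℕ) : ℝ) * densityAt ψ 0 y) ^ 3) := by
          gcongr
      _ = _ := by
          simp only [Fin.mk_zero]
          ring
end
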